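/- arXiv:1603.04517 — 3 statements merged into one kernel-verified Lean document; each statement's English description precedes it below -/
import Mathlib

section
/- For every integer l ≥ 2, the derivative at t = 1 of the skew-growth function of type B_l satisfies N'_{B_l}(1) = Σ_{J ⊆ {1,...,l}} (-1)^{#J} · deg_B(J) = (-1)^l · l. -/
open scoped Classical

/-- Adjacency for the type `A_l` Coxeter graph (the path `1—2—⋯—l`). -/
def adjA (a b : ℕ) : Prop := b = a + 1

/-- Adjacency for the type `D_l` Coxeter graph on `{1,…,l}`: edges `{i, i+1}` for
`1 ≤ i ≤ l-2` together with the edge `{l-2, l}` (so `l-1` and `l` are not adjacent). -/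
def adjD (l : ℕ) (a b : ℕ) : Prop :=
  (b = a + 1 ∧ a ≠ l - 1) ∨ (a = l - 2 ∧ b = l)

/-- The vertex sets of the connected components of the graph induced on the finite
set `J` by the (symmetrized) adjacency relation `r`. -/
noncomputable def componentsOf (r : ℕ → ℕ → Prop) (J : Finset ℕ) : Finset (Finset ℕ) :=
  J.image fun x =>
    J.filter fun y =>
      Relation.ReflTransGen (fun a b => a ∈ J ∧ b ∈ J ∧ (r a b ∨ r b a)) x y

/-- The number of maximal blocks of consecutive integers in `J`
(the connected components of the induced subgraph of the path graph). -/
noncomputable def kA (J : Finset ℕ) : ℕ := (componentsOf adjA J).card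

/-- The degree of the fundamental element of the Artin monoid of type `A_l`
associated to `J`: the sum over the maximal consecutive blocks `B` of `J`
of `binom(#B + 1, 2)`. -/
noncomputable def degA (J : Finset ℕ) : ℕ :=
  ∑ B ∈ componentsOf adjA J, (B.card + 1).choose 2

/-- The degree of the fundamental element of the Artin monoid of type `B_l`
associated to `J`: the sum over the maximal consecutive blocks `B` of `J` of
`(#B)^2` if `{1,2} ⊆ B` and `binom(#B + 1, 2)` otherwise. -/
noncomputable def degB (J : Finset ℕ) : ℕ :=
  ∑ B ∈ componentsOf adjA J,
    if 1 ∈ B ∧ 2 ∈ B then B.card ^ 2 else (B.card + 1).choose 2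

/-- The degree of the fundamental element of the Artin monoid of type `D_l`
associated to `J`: the sum over the connected components `C` of the induced
subgraph of the type `D_l` Coxeter graph on `J` of `#C·(#C - 1)` if
`{l-1, l} ⊆ C` and `binom(#C + 1, 2)` otherwise. -/
noncomputable def degD (l : ℕ) (J : Finset ℕ) : ℕ :=
  ∑ C ∈ componentsOf (adjD l) J,
    if l - 1 ∈ C ∧ l ∈ C then C.card * (C.card - 1) else (C.card + 1).choose 2



/-- The reachability relation inside `J` is the containment of the whole interval. -/
theorem reach_iff (J : Finset ℕ) (x y : ℕ) (hx : x ∈ J) :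
    Relation.ReflTransGen (fun a b => a ∈ J ∧ b ∈ J ∧ (adjA a b ∨ adjA b a)) x y ↔
      ∀ z, (x ≤ z ∧ z ≤ y) ∨ (y ≤ z ∧ z ≤ x) → z ∈ J := by
  constructor
  · intro h
    induction h with
    | refl => intro z hz; have : z = x := by omega
              exact this ▸ hx
    | @tail b c _ h ih =>
      intro z hz
      obtain ⟨hb, hc, h⟩ := h
      unfold adjA at h
      by_cases hzc : z = c
      · exact hzc ▸ hc
      · apply ih; omega
  · intro h
    rcases le_total x y with hxy | hxy
    · induction y, hxy using Nat.le_induction with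
      | base => exact .refl
      | succ n hn ih =>
        refine .tail (ih fun z hz => h z (by omega)) ⟨h n (by omega), h _ (by omega), Or.inl rfl⟩
    · obtain ⟨k, rfl⟩ := Nat.exists_eq_add_of_le hxy
      clear hxy
      induction k generalizing y with
      | zero => exact .refl
      | succ n ih =>
        have e : y + (n + 1) = (y + 1) + n := by omega
        rw [e] at h hx ⊢
        refine .tail (ih (y + 1) hx fun z hz => h z (by omega)) 
          ⟨h _ (by omega), h _ (by omega), Or.inr rfl⟩

/-- The weight of an interval `[a,b]`. -/
def wB (a b : ℕ) : ℕ := if a = 1 then b else 1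

theorem sum_wB (p q : ℕ) (hp : 1 ≤ p) (hpq : p ≤ q) :
    (if 1 ∈ Finset.Icc p q ∧ 2 ∈ Finset.Icc p q then (Finset.Icc p q).card ^ 2
      else ((Finset.Icc p q).card + 1).choose 2) =
    ∑ b ∈ Finset.Icc p q, ∑ a ∈ Finset.Icc p b, wB a b := by
  rcases Nat.lt_or_ge 1 p with h | h
  · rw [if_neg (by simp; omega)]
    have h1 : ∀ b ∈ Finset.Icc p q, ∑ a ∈ Finset.Icc p b, wB a b = b + 1 - p := by
      intro b _
      rw [Finset.sum_congr rfl (g := fun _ => 1)]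
      · simp
      · intro a ha
        rw [Finset.mem_Icc] at ha
        rw [wB, if_neg (by omega)]
    rw [Finset.sum_congr rfl h1, Nat.card_Icc]
    clear h1
    induction q, hpq using Nat.le_induction with
    | base => simp
    | succ n hn ih =>
      rw [Finset.sum_Icc_succ_top (by omega), ← ih]
      have e : n + 1 + 1 - p = (n + 1 - p) + 1 := by omega
      rw [e, Nat.choose_succ_succ' (n + 1 - p + 1) 1]
      simp; omega
  · obtain rfl : p = 1 := by omega
    have h1 : ∀ b ∈ Finset.Icc 1 q, ∑ a ∈ Finset.Icc 1 b, wB a b = b + (b - 1) := by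
      intro b hb
      rw [Finset.mem_Icc] at hb
      rw [← Finset.add_sum_Ioc_eq_sum_Icc hb.1, Finset.sum_congr rfl (g := fun _ => 1)]
      · simp [wB]
      · intro a ha
        rw [Finset.mem_Ioc] at ha
        rw [wB, if_neg (by omega)]
    have h2 : ∑ b ∈ Finset.Icc 1 q, (b + (b - 1)) = q ^ 2 := by
      clear h1
      induction q, hpq using Nat.le_induction with
      | base => simp
      | succ n hn ih =>
        rw [Finset.sum_Icc_succ_top (by omega), ih]
        simp; ring
    rw [Finset.sum_congr rfl h1, h2, Nat.card_Icc]
    split_ifs with h3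
    · simp
    · simp at h3
      obtain rfl : q = 1 := by omega
      simp

theorem degB_eq (J : Finset ℕ) (hJ : ∀ x ∈ J, 1 ≤ x) :
    degB J = ∑ b ∈ J, ∑ a ∈ J with a ≤ b ∧ Finset.Icc a b ⊆ J, wB a b := by
  unfold degB componentsOf
  apply Finset.sum_image'
  intro i hi
  have key : ∀ x ∈ J, ∀ y, y ∈ (J.filter fun y => 
      Relation.ReflTransGen (fun a b => a ∈ J ∧ b ∈ J ∧ (adjA a b ∨ adjA b a)) x y) ↔
      ∀ z, (x ≤ z ∧ z ≤ y) ∨ (y ≤ z ∧ z ≤ x) → z ∈ J := by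
    intro x hx y
    rw [Finset.mem_filter, reach_iff J x y hx]
    exact ⟨fun h => h.2, fun h => ⟨h y (by omega), h⟩⟩
  generalize hc : (fun x => J.filter fun y => 
      Relation.ReflTransGen (fun a b => a ∈ J ∧ b ∈ J ∧ (adjA a b ∨ adjA b a)) x y) = c
  have hc' : ∀ x, (J.filter fun y => 
      Relation.ReflTransGen (fun a b => a ∈ J ∧ b ∈ J ∧ (adjA a b ∨ adjA b a)) x y) = c x := by
    intro x; rw [← hc]
  simp only [hc'] at key ⊢
  clear hc hc'
  have hii : i ∈ c i := (key i hi i).2 fun z hz => by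
    obtain rfl : z = i := by omega
    exact hi
  have hfib : (J.filter fun j => c j = c i) = c i := by
    ext j
    rw [Finset.mem_filter]
    constructor
    · rintro ⟨hj, h⟩
      rw [← h, key j hj]
      intro z hz
      obtain rfl : z = j := by omega
      exact hj
    · intro h
      rw [key i hi] at h
      have hj : j ∈ J := h j (by omega)
      refine ⟨hj, ?_⟩
      ext y
      rw [key j hj, key i hi]
      constructor
      · intro h' z hz
        by_cases hz' : (i ≤ z ∧ z ≤ j) ∨ (j ≤ z ∧ z ≤ i)
        · exact h z hz'
        · exact h' z (by omega)
      · intro h' z hz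
        by_cases hz' : (i ≤ z ∧ z ≤ j) ∨ (j ≤ z ∧ z ≤ i)
        · exact h z hz'
        · exact h' z (by omega)
  obtain ⟨p, q, hpi, hiq, hpq⟩ : ∃ p q, p ≤ i ∧ i ≤ q ∧ c i = Finset.Icc p q := by
    refine ⟨(c i).min' ⟨i, hii⟩, (c i).max' ⟨i, hii⟩, Finset.min'_le _ _ hii,
      Finset.le_max' _ _ hii, ?_⟩
    ext y
    rw [Finset.mem_Icc]
    constructor
    · intro h
      exact ⟨Finset.min'_le _ _ h, Finset.le_max' _ _ h⟩
    · rintro ⟨h1, h2⟩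
      have m1 := (key i hi _).1 (Finset.min'_mem (c i) ⟨i, hii⟩)
      have m2 := (key i hi _).1 (Finset.max'_mem (c i) ⟨i, hii⟩)
      rw [key i hi]
      intro z hz
      rcases hz with hz | hz
      · exact m2 z (by omega)
      · exact m1 z (by omega)
  have hmem : ∀ y, (p ≤ y ∧ y ≤ q) ↔
      ∀ z, (i ≤ z ∧ z ≤ y) ∨ (y ≤ z ∧ z ≤ i) → z ∈ J := by
    intro y
    rw [← key i hi, hpq, Finset.mem_Icc]
  have hsub : ∀ y, p ≤ y → y ≤ q → y ∈ J := fun y h1 h2 =>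
    (hmem y).1 ⟨h1, h2⟩ y (by omega)
  rw [hfib, hpq, sum_wB p q (hJ p (hsub p (by omega) (by omega))) (by omega)]
  apply Finset.sum_congr rfl
  intro b hb
  rw [Finset.mem_Icc] at hb
  apply Finset.sum_congr _ fun _ _ => rfl
  ext a
  rw [Finset.mem_filter, Finset.mem_Icc]
  symm
  constructor
  · rintro ⟨ha, ⟨hab, h⟩⟩
    refine ⟨?_, hab⟩
    by_contra hap
    have := (hmem a).2 fun z hz => by
      by_cases hzb : z ≤ b ∧ a ≤ z
      · exact h (Finset.mem_Icc.2 ⟨hzb.2, hzb.1⟩)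
      · exact hsub z (by omega) (by omega)
    omega
  · rintro ⟨h1, h2⟩
    refine ⟨hsub a h1 (by omega), h2, fun z hz => ?_⟩
    rw [Finset.mem_Icc] at hz
    exact hsub z (by omega) (by omega)

theorem alt_sum (I S : Finset ℕ) (hS : S ⊆ I) :
    ∑ J ∈ I.powerset, (if S ⊆ J then (-1 : ℤ) ^ J.card else 0) =
      if S = I then (-1) ^ I.card else 0 := by
  rw [← Finset.sum_filter]
  have : (I.powerset.filter fun J => S ⊆ J) = (I \ S).powerset.image (fun T => S ∪ T) := by
    rw [← Finset.Icc_eq_image_powerset hS]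
    ext J
    simp [and_comm]
  rw [this, Finset.sum_image]
  · have h : ∀ T ∈ (I \ S).powerset, (-1 : ℤ) ^ (S ∪ T).card = (-1) ^ S.card * (-1) ^ T.card := by
      intro T hT
      rw [Finset.mem_powerset] at hT
      rw [Finset.card_union_of_disjoint, pow_add]
      exact Finset.disjoint_of_subset_right hT Finset.disjoint_sdiff
    rw [Finset.sum_congr rfl h, ← Finset.mul_sum, Finset.sum_powerset_neg_one_pow_card]
    by_cases hSI : S = I
    · subst hSI; simp
    · rw [if_neg hSI, if_neg, mul_zero]
      intro h0
      exact hSI (hS.antisymm (Finset.sdiff_eq_empty_iff_subset.1 h0))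
  · intro T hT T' hT' h
    simp only [Finset.coe_powerset, Set.mem_preimage, Set.mem_powerset_iff, Finset.coe_subset] at hT hT'
    ext x
    have := Finset.ext_iff.1 h x
    have h1 := @hT x
    have h2 := @hT' x
    simp only [Finset.mem_union, Finset.mem_sdiff] at this h1 h2
    tauto

/-- For every integer `l ≥ 2`, the derivative at `t = 1` of the skew-growth function of
type `B_l` satisfies `N'_{B_l}(1) = Σ_{J ⊆ {1,…,l}} (-1)^{#J} · deg_B(J) = (-1)^l · l`. -/
theorem skew_growth_deriv_one_typeB (l : ℕ) (hl : 2 ≤ l) :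
    Polynomial.eval (1 : ℤ) (Polynomial.derivative
        (∑ J ∈ (Finset.Icc 1 l).powerset,
          (-1 : Polynomial ℤ) ^ J.card * Polynomial.X ^ degB J))
      = ∑ J ∈ (Finset.Icc 1 l).powerset, (-1 : ℤ) ^ J.card * (degB J : ℤ) ∧
    ∑ J ∈ (Finset.Icc 1 l).powerset, (-1 : ℤ) ^ J.card * (degB J : ℤ) = (-1) ^ l * l := by
  constructor
  · rw [Polynomial.derivative_sum, Polynomial.eval_finsetSum]
    apply Finset.sum_congr rfl
    intro J _
    have : (-1 : Polynomial ℤ) ^ J.card = Polynomial.C ((-1 : ℤ) ^ J.card) := by simp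
    rw [this, Polynomial.derivative_C_mul, Polynomial.derivative_X_pow]
    simp
  · have h1 : ∀ J ∈ (Finset.Icc 1 l).powerset, (-1 : ℤ) ^ J.card * (degB J : ℤ) =
        ∑ b ∈ Finset.Icc 1 l, ∑ a ∈ Finset.Icc 1 b,
          (wB a b : ℤ) * (if Finset.Icc a b ⊆ J then (-1 : ℤ) ^ J.card else 0) := by
      intro J hJ
      rw [Finset.mem_powerset] at hJ
      rw [degB_eq J fun x hx => (Finset.mem_Icc.1 (hJ hx)).1]
      push_cast
      rw [Finset.mul_sum]
      rw [← Finset.sum_subset hJ]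
      · apply Finset.sum_congr rfl
        intro b hb
        simp only [mul_ite, mul_zero]
        rw [← Finset.sum_filter, Finset.mul_sum]
        apply Finset.sum_congr
        · ext a
          simp only [Finset.mem_filter, Finset.mem_Icc]
          constructor
          · rintro ⟨h1, h2, h3⟩
            exact ⟨⟨(Finset.mem_Icc.1 (hJ h1)).1, h2⟩, h3⟩
          · rintro ⟨⟨h1, h2⟩, h3⟩
            exact ⟨h3 (Finset.mem_Icc.2 ⟨le_rfl, h2⟩), h2, h3⟩
        · intro a _
          ring
      · intro b _ hb
        apply Finset.sum_eq_zero
        intro a ha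
        rw [Finset.mem_Icc] at ha
        rw [if_neg, mul_zero]
        intro h
        exact hb (h (Finset.mem_Icc.2 ⟨ha.2, le_rfl⟩))
    rw [Finset.sum_congr rfl h1, Finset.sum_comm]
    have h2 : ∀ b ∈ Finset.Icc 1 l, ∑ J ∈ (Finset.Icc 1 l).powerset, ∑ a ∈ Finset.Icc 1 b,
          (wB a b : ℤ) * (if Finset.Icc a b ⊆ J then (-1 : ℤ) ^ J.card else 0) =
        if b = l then (-1) ^ l * (l : ℤ) else 0 := by
      intro b hb
      rw [Finset.mem_Icc] at hb
      rw [Finset.sum_comm]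
      have h3 : ∀ a ∈ Finset.Icc 1 b, ∑ J ∈ (Finset.Icc 1 l).powerset,
          (wB a b : ℤ) * (if Finset.Icc a b ⊆ J then (-1 : ℤ) ^ J.card else 0) =
          if a = 1 then (if b = l then (-1) ^ l * (l : ℤ) else 0) else 0 := by
        intro a ha
        rw [Finset.mem_Icc] at ha
        rw [← Finset.mul_sum, alt_sum _ _ (Finset.Icc_subset_Icc ha.1 hb.2)]
        by_cases h : a = 1 ∧ b = l
        · obtain ⟨rfl, rfl⟩ := h
          simp [wB, mul_comm]
        · rw [if_neg]
          · split_ifs <;> first | (exfalso; tauto) | simp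
          · intro he
            have e1 : 1 ∈ Finset.Icc a b := he ▸ Finset.mem_Icc.2 ⟨le_rfl, by omega⟩
            have e2 : l ∈ Finset.Icc a b := he ▸ Finset.mem_Icc.2 ⟨by omega, le_rfl⟩
            rw [Finset.mem_Icc] at e1 e2
            omega
      rw [Finset.sum_congr rfl h3, Finset.sum_ite_eq' _ 1, if_pos (Finset.mem_Icc.2 ⟨le_rfl, hb.1⟩)]
    rw [Finset.sum_congr rfl h2, Finset.sum_ite_eq' _ l,
      if_pos (Finset.mem_Icc.2 ⟨by omega, le_rfl⟩)]
end

section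
/- For every integer l ≥ 1, the skew-growth polynomial N_{A_l}(t) = Σ_{J ⊆ {1,...,l}} (-1)^{#J} t^{deg_A(J)} ∈ ℤ[t] has t = 1 as a root of multiplicity exactly one (a simple root). -/
open scoped Classical

/-- The skew-growth polynomial of type `A_l`. -/
noncomputable def NA (l : ℕ) : Polynomial ℤ :=
  ∑ J ∈ (Finset.Icc 1 l).powerset, (-1 : Polynomial ℤ) ^ J.card * Polynomial.X ^ degA J

/-- The path-connectivity relation on `J`. -/
def connA (J : Finset ℕ) : ℕ → ℕ → Prop :=
  Relation.ReflTransGen (fun a b => a ∈ J ∧ b ∈ J ∧ (adjA a b ∨ adjA b a))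

/-- The component of `x`. -/
noncomputable def compA (J : Finset ℕ) (x : ℕ) : Finset ℕ := J.filter fun y => connA J x y

theorem connA_symm {J : Finset ℕ} {x y : ℕ} (h : connA J x y) : connA J y x := by
  induction h with
  | refl => exact Relation.ReflTransGen.refl
  | tail _ hbc ih => exact Relation.ReflTransGen.head ⟨hbc.2.1, hbc.1, hbc.2.2.symm⟩ ih

theorem connA_trans {J : Finset ℕ} {x y z : ℕ} (h : connA J x y) (h' : connA J y z) :
    connA J x z := Relation.ReflTransGen.trans h h'

theorem connA_between {J : Finset ℕ} {x y : ℕ} (hx : x ∈ J) (h : connA J x y) :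
    ∀ z, (x ≤ z ∧ z ≤ y) ∨ (y ≤ z ∧ z ≤ x) → z ∈ J := by
  induction h with
  | refl => intro z hz; obtain rfl : z = x := by omega
            exact hx
  | @tail b c _ hbc ih =>
    intro z hz
    obtain ⟨hb, hc, h⟩ := hbc
    unfold adjA at h
    by_cases hzc : z = c
    · exact hzc ▸ hc
    by_cases hzb : z = b
    · exact hzb ▸ hb
    exact ih z (by omega)

theorem connA_of_Icc {J : Finset ℕ} {x : ℕ} (k : ℕ) (h : Finset.Icc x (x + k) ⊆ J) :
    connA J x (x + k) := by
  induction k with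
  | zero => exact Relation.ReflTransGen.refl
  | succ k ih =>
    refine Relation.ReflTransGen.tail (ih ?_) ⟨?_, ?_, Or.inl rfl⟩
    · intro z hz; apply h; simp only [Finset.mem_Icc] at *; omega
    · apply h; simp only [Finset.mem_Icc]; omega
    · apply h; simp only [Finset.mem_Icc]; omega

theorem connA_iff {J : Finset ℕ} {x y : ℕ} (hx : x ∈ J) (hxy : x ≤ y) :
    connA J x y ↔ Finset.Icc x y ⊆ J := by
  constructor
  · intro h z hz
    exact connA_between hx h z (Or.inl (Finset.mem_Icc.1 hz))
  · intro h
    obtain ⟨k, rfl⟩ := Nat.exists_eq_add_of_le hxy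
    exact connA_of_Icc k h

theorem compA_eq_iff {J : Finset ℕ} {x y : ℕ} (hx : x ∈ J) :
    compA J x = compA J y ↔ connA J y x := by
  constructor
  · intro h
    have : x ∈ compA J x := Finset.mem_filter.2 ⟨hx, Relation.ReflTransGen.refl⟩
    rw [h] at this
    exact (Finset.mem_filter.1 this).2
  · intro h
    ext z
    simp only [compA, Finset.mem_filter]
    exact and_congr_right fun _ => ⟨fun h' => connA_trans h h',
      fun h' => connA_trans (connA_symm h) h'⟩

theorem card_le_pairs (B : Finset ℕ) :
    ((B ×ˢ B).filter fun p => p.1 ≤ p.2).card = (B.card + 1).choose 2 := by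
  rw [← Finset.card_sym2]
  refine Finset.card_bij (fun p _ => s(p.1, p.2)) ?_ ?_ ?_
  · rintro ⟨a, b⟩ h
    simp only [Finset.mem_filter, Finset.mem_product] at h
    simpa using h.1
  · rintro ⟨a, b⟩ h ⟨c, d⟩ h' e
    simp only [Finset.mem_filter, Finset.mem_product] at h h'
    simp only [Sym2.eq_iff] at e
    simp only [Prod.mk.injEq]
    omega
  · intro s
    induction s using Sym2.ind with
    | _ a b =>
      intro h
      rw [Finset.mk_mem_sym2_iff] at h
      rcases le_total a b with hab | hab
      · exact ⟨(a, b), by simp [h, hab], rfl⟩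
      · exact ⟨(b, a), by simp [h, hab], Sym2.eq_swap⟩

theorem degA_eq (J : Finset ℕ) :
    degA J = ((J ×ˢ J).filter fun p => p.1 ≤ p.2 ∧ Finset.Icc p.1 p.2 ⊆ J).card := by
  have hc : componentsOf adjA J = J.image (compA J) := rfl
  unfold degA
  rw [hc, Finset.card_eq_sum_card_fiberwise (f := fun p => compA J p.1) (t := J.image (compA J))]
  · refine Finset.sum_congr rfl ?_
    intro B hB
    obtain ⟨x, hx, rfl⟩ := Finset.mem_image.1 hB
    rw [← card_le_pairs]
    congr 1
    ext ⟨a, b⟩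
    simp only [Finset.mem_filter, Finset.mem_product]
    constructor
    · rintro ⟨⟨ha, hb⟩, hab⟩
      have ha' := Finset.mem_filter.1 ha
      have hb' := Finset.mem_filter.1 hb
      exact ⟨⟨⟨ha'.1, hb'.1⟩, hab,
        (connA_iff ha'.1 hab).1 (connA_trans (connA_symm ha'.2) hb'.2)⟩,
        (compA_eq_iff ha'.1).2 ha'.2⟩
    · rintro ⟨⟨⟨ha, hb⟩, hab, hI⟩, he⟩
      have h1 := (compA_eq_iff ha).1 he
      have h2 := (connA_iff ha hab).2 hI
      exact ⟨⟨Finset.mem_filter.2 ⟨ha, h1⟩, Finset.mem_filter.2 ⟨hb, connA_trans h1 h2⟩⟩, hab⟩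
  · rintro ⟨a, b⟩ h
    have h' := Finset.mem_filter.1 (Finset.mem_coe.1 h)
    exact Finset.mem_coe.2 (Finset.mem_image_of_mem _ (Finset.mem_product.1 h'.1).1)

theorem alt_sum_superset (I S : Finset ℕ) (hS : S ⊆ I) :
    ∑ J ∈ I.powerset, (if S ⊆ J then (-1 : ℤ) ^ J.card else 0)
      = if S = I then (-1 : ℤ) ^ I.card else 0 := by
  by_cases h : S = I
  · subst h
    rw [if_pos rfl, Finset.sum_eq_single S]
    · simp
    · intro J hJ hne
      rw [if_neg]
      intro h
      exact hne (Finset.Subset.antisymm (Finset.mem_powerset.1 hJ) h)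
    · simp
  · rw [if_neg h]
    obtain ⟨x, hxI, hxS⟩ : ∃ x ∈ I, x ∉ S := by
      by_contra! hc
      exact h (Finset.Subset.antisymm hS hc)
    rw [← Finset.insert_erase hxI, Finset.sum_powerset_insert (Finset.notMem_erase x I),
      ← Finset.sum_add_distrib]
    refine Finset.sum_eq_zero ?_
    intro J hJ
    have hxJ : x ∉ J := fun hh => Finset.notMem_erase x I (Finset.mem_powerset.1 hJ hh)
    have : S ⊆ insert x J ↔ S ⊆ J := Finset.subset_insert_iff_of_notMem hxS
    simp only [this, Finset.card_insert_of_notMem hxJ]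
    split_ifs <;> ring

theorem alt_sum_deg (l : ℕ) (hl : 1 ≤ l) :
    ∑ J ∈ (Finset.Icc 1 l).powerset, (-1 : ℤ) ^ J.card * (degA J : ℤ) = (-1) ^ l := by
  set I := Finset.Icc 1 l with hI
  set P := (I ×ˢ I).filter fun p => p.1 ≤ p.2 with hP
  have h1 : ∀ J ∈ I.powerset, (-1 : ℤ) ^ J.card * (degA J : ℤ)
      = ∑ p ∈ P, if Finset.Icc p.1 p.2 ⊆ J then (-1 : ℤ) ^ J.card else 0 := by
    intro J hJ
    have hJ' := Finset.mem_powerset.1 hJ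
    have : ((J ×ˢ J).filter fun p => p.1 ≤ p.2 ∧ Finset.Icc p.1 p.2 ⊆ J)
        = P.filter fun p => Finset.Icc p.1 p.2 ⊆ J := by
      ext ⟨a, b⟩
      simp only [hP, Finset.mem_filter, Finset.mem_product]
      constructor
      · rintro ⟨⟨ha, hb⟩, hab, h⟩
        exact ⟨⟨⟨hJ' ha, hJ' hb⟩, hab⟩, h⟩
      · rintro ⟨⟨_, hab⟩, h⟩
        exact ⟨⟨h (Finset.left_mem_Icc.2 hab), h (Finset.right_mem_Icc.2 hab)⟩, hab, h⟩
    rw [degA_eq, this, ← Finset.sum_filter, Finset.sum_const, nsmul_eq_mul, mul_comm]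
  rw [Finset.sum_congr rfl h1, Finset.sum_comm]
  have h2 : ∀ p ∈ P, (∑ J ∈ I.powerset, if Finset.Icc p.1 p.2 ⊆ J then (-1 : ℤ) ^ J.card else 0)
      = if p = (1, l) then (-1 : ℤ) ^ l else 0 := by
    rintro ⟨a, b⟩ hp
    simp only [hP, hI, Finset.mem_filter, Finset.mem_product, Finset.mem_Icc] at hp
    rw [alt_sum_superset]
    · have : Finset.Icc a b = I ↔ (a, b) = (1, l) := by
        simp only [Prod.mk.injEq]
        constructor
        · intro h
          have h3 : 1 ∈ Finset.Icc a b := by rw [h, hI, Finset.mem_Icc]; omega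
          have h4 : l ∈ Finset.Icc a b := by rw [h, hI, Finset.mem_Icc]; omega
          rw [Finset.mem_Icc] at h3 h4
          omega
        · rintro ⟨rfl, rfl⟩; rfl
      have hcard : I.card = l := by simp [hI]
      simp only [this, hcard]
    · intro z hz
      simp only [hI, Finset.mem_Icc] at *
      omega
  rw [Finset.sum_congr rfl h2, Finset.sum_ite_eq', if_pos]
  simp only [hP, hI, Finset.mem_filter, Finset.mem_product, Finset.mem_Icc]
  omega

/-- For every integer `l ≥ 1`, the skew-growth polynomial `N_{A_l}(t)` has `t = 1`
as a root of multiplicity exactly one. -/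
theorem skew_growth_simple_root_typeA (l : ℕ) (hl : 1 ≤ l) :
    Polynomial.rootMultiplicity 1 (NA l) = 1 := by
  have hroot : (NA l).eval 1 = 0 := by
    have h := alt_sum_superset (Finset.Icc 1 l) ∅ (Finset.empty_subset _)
    have hne : (∅ : Finset ℕ) ≠ Finset.Icc 1 l := by
      intro h
      have : 1 ∈ Finset.Icc 1 l := by simp [hl]
      rw [← h] at this
      simp at this
    rw [if_neg hne] at h
    simpa [NA, Polynomial.eval_finsetSum] using h
  have hder : (Polynomial.derivative (NA l)).eval 1 = (-1) ^ l := by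
    rw [← alt_sum_deg l hl]
    unfold NA
    rw [Polynomial.derivative_sum, Polynomial.eval_finsetSum]
    refine Finset.sum_congr rfl ?_
    intro J _
    have hC : ((-1 : Polynomial ℤ)) ^ J.card = Polynomial.C ((-1 : ℤ) ^ J.card) := by simp
    rw [hC, Polynomial.derivative_C_mul, Polynomial.derivative_X_pow]
    simp
  have hder0 : (Polynomial.derivative (NA l)).eval 1 ≠ 0 := by
    rw [hder]; exact pow_ne_zero _ (by norm_num)
  have hne : NA l ≠ 0 := by
    intro h; apply hder0; rw [h]; simp
  have h1 : 0 < Polynomial.rootMultiplicity 1 (NA l) :=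
    (Polynomial.rootMultiplicity_pos hne).2 hroot
  have h2 : ¬ 1 < Polynomial.rootMultiplicity 1 (NA l) := by
    rw [Polynomial.one_lt_rootMultiplicity_iff_isRoot hne]
    exact fun h => hder0 h.2
  omega
end

section
/- For every integer l ≥ 5, N'_{D_l}(1) − N'_{D_{l-1}}(1) = (-1)^l · (2l - 5), where N'_{D_l}(1) = Σ_{J ⊆ {1,...,l}} (-1)^{#J} deg_D(J). -/
open scoped Classical

/-- `C` is connected for the symmetrized relation `r`. -/
def ConnOn (r : ℕ → ℕ → Prop) (C : Finset ℕ) : Prop :=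
  ∀ x ∈ C, ∀ y ∈ C, Relation.ReflTransGen (fun a b => a ∈ C ∧ b ∈ C ∧ (r a b ∨ r b a)) x y

lemma rtg_symm (r : ℕ → ℕ → Prop) (C : Finset ℕ) {x y : ℕ}
    (h : Relation.ReflTransGen (fun a b => a ∈ C ∧ b ∈ C ∧ (r a b ∨ r b a)) x y) :
    Relation.ReflTransGen (fun a b => a ∈ C ∧ b ∈ C ∧ (r a b ∨ r b a)) y x := by
  induction h with
  | refl => exact .refl
  | tail _ h ih => exact .head ⟨h.2.1, h.1, h.2.2.symm⟩ ih

lemma mem_componentsOf (r : ℕ → ℕ → Prop) (J C : Finset ℕ) :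
    C ∈ componentsOf r J ↔ C.Nonempty ∧ C ⊆ J ∧ ConnOn r C ∧
      ∀ a ∈ C, ∀ b ∈ J, (r a b ∨ r b a) → b ∈ C := by
  unfold componentsOf
  rw [Finset.mem_image]
  constructor
  · rintro ⟨x, hx, rfl⟩
    set C := J.filter fun y =>
      Relation.ReflTransGen (fun a b => a ∈ J ∧ b ∈ J ∧ (r a b ∨ r b a)) x y with hC
    have hmem : ∀ y, y ∈ C ↔ y ∈ J ∧
      Relation.ReflTransGen (fun a b => a ∈ J ∧ b ∈ J ∧ (r a b ∨ r b a)) x y := by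
      intro y; rw [hC, Finset.mem_filter]
    clear_value C
    have key : ∀ y, Relation.ReflTransGen (fun a b => a ∈ J ∧ b ∈ J ∧ (r a b ∨ r b a)) x y →
        Relation.ReflTransGen (fun a b => a ∈ C ∧ b ∈ C ∧ (r a b ∨ r b a)) x y := by
      intro y h
      induction h with
      | refl => exact .refl
      | tail h1 h2 ih =>
        exact .tail ih ⟨(hmem _).2 ⟨h2.1, h1⟩, (hmem _).2 ⟨h2.2.1, h1.tail h2⟩, h2.2.2⟩
    refine ⟨⟨x, (hmem x).2 ⟨hx, .refl⟩⟩, fun y hy => ((hmem y).1 hy).1, ?_, ?_⟩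
    · intro y hy z hz
      exact (rtg_symm r C (key y ((hmem y).1 hy).2)).trans (key z ((hmem z).1 hz).2)
    · intro a ha b hb hab
      exact (hmem b).2 ⟨hb, ((hmem a).1 ha).2.tail ⟨((hmem a).1 ha).1, hb, hab⟩⟩
  · rintro ⟨⟨x, hx⟩, hCJ, hconn, hcl⟩
    refine ⟨x, hCJ hx, ?_⟩
    ext y
    rw [Finset.mem_filter]
    constructor
    · rintro ⟨_, h⟩
      induction h with
      | refl => exact hx
      | tail h1 h2 ih => exact hcl _ (ih h2.1) _ h2.2.1 h2.2.2
    · intro hy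
      exact ⟨hCJ hy, Relation.ReflTransGen.mono
        (fun a b h => ⟨hCJ h.1, hCJ h.2.1, h.2.2⟩) _ _ (hconn x hx y hy)⟩

/-- `C` is a nonempty connected dominating set in `I`. -/
def Good (r : ℕ → ℕ → Prop) (I C : Finset ℕ) : Prop :=
  C.Nonempty ∧ ConnOn r C ∧ ∀ v ∈ I, v ∈ C ∨ ∃ a ∈ C, r a v ∨ r v a

lemma main_sum (r : ℕ → ℕ → Prop) (I : Finset ℕ) (f : Finset ℕ → ℤ) :
    ∑ J ∈ I.powerset, (-1 : ℤ) ^ J.card * ∑ C ∈ componentsOf r J, f C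
      = ∑ C ∈ I.powerset with Good r I C, (-1 : ℤ) ^ C.card * f C := by
  have h1 : ∀ J ∈ I.powerset, (-1 : ℤ) ^ J.card * ∑ C ∈ componentsOf r J, f C =
      ∑ C ∈ I.powerset, (-1 : ℤ) ^ J.card * (if C ∈ componentsOf r J then f C else 0) := by
    intro J hJ
    rw [← Finset.mul_sum, ← Finset.sum_filter]
    congr 2
    ext C
    rw [Finset.mem_filter, Finset.mem_powerset]
    rw [Finset.mem_powerset] at hJ
    exact ⟨fun h => ⟨((mem_componentsOf r J C).1 h).2.1.trans hJ, h⟩, fun h => h.2⟩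
  rw [Finset.sum_congr rfl h1, Finset.sum_comm, Finset.sum_filter]
  refine Finset.sum_congr rfl fun C hC => ?_
  rw [Finset.mem_powerset] at hC
  by_cases hne : C.Nonempty ∧ ConnOn r C
  · by_cases hd : ∀ v ∈ I, v ∈ C ∨ ∃ a ∈ C, r a v ∨ r v a
    · rw [if_pos ⟨hne.1, hne.2, hd⟩, Finset.sum_eq_single C]
      · rw [if_pos]
        rw [mem_componentsOf]
        exact ⟨hne.1, subset_rfl, hne.2, fun a _ b hb _ => hb⟩
      · intro J hJ hJC
        rw [Finset.mem_powerset] at hJ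
        rw [if_neg, mul_zero]
        rw [mem_componentsOf]
        rintro ⟨_, hCJ, _, hcl⟩
        apply hJC
        refine Finset.Subset.antisymm (fun v hv => ?_) hCJ
        rcases hd v (hJ hv) with h | ⟨a, ha, hav⟩
        · exact h
        · exact hcl a ha v hv hav
      · intro h
        exact absurd (Finset.mem_powerset.2 hC) h
    · rw [if_neg (fun h => hd h.2.2)]
      push Not at hd
      obtain ⟨v, hv, hvC, hva⟩ := hd
      have hI : I = insert v (I.erase v) := (Finset.insert_erase hv).symm
      rw [hI, Finset.sum_powerset_insert (Finset.notMem_erase v I), ← Finset.sum_add_distrib]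
      refine Finset.sum_eq_zero fun J hJ => ?_
      rw [Finset.mem_powerset] at hJ
      have hvJ : v ∉ J := fun h => Finset.notMem_erase v I (hJ h)
      have hiff : C ∈ componentsOf r (insert v J) ↔ C ∈ componentsOf r J := by
        rw [mem_componentsOf, mem_componentsOf, Finset.subset_insert_iff_of_notMem hvC]
        constructor
        · rintro ⟨a1, a2, a3, a4⟩
          exact ⟨a1, a2, a3, fun a ha b hb => a4 a ha b (Finset.mem_insert_of_mem hb)⟩
        · rintro ⟨a1, a2, a3, a4⟩
          refine ⟨a1, a2, a3, fun a ha b hb hab => ?_⟩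
          rcases Finset.mem_insert.1 hb with rfl | hb
          · have := hva a ha
            tauto
          · exact a4 a ha b hb hab
      simp only [hiff]
      rw [Finset.card_insert_of_notMem hvJ, pow_succ]
      ring
  · rw [if_neg (fun h => hne ⟨h.1, h.2.1⟩)]
    refine Finset.sum_eq_zero fun J _ => ?_
    rw [if_neg, mul_zero]
    rw [mem_componentsOf]
    exact fun h => hne ⟨h.1, h.2.2.1⟩

lemma good_iff (m : ℕ) (C : Finset ℕ) (hC : C ⊆ Finset.Icc 1 (m + 4)) :
    Good (adjD (m + 4)) (Finset.Icc 1 (m + 4)) C ↔ Finset.Icc 2 (m + 2) ⊆ C := by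
  have hC' : ∀ x ∈ C, 1 ≤ x ∧ x ≤ m + 4 := fun x hx => Finset.mem_Icc.1 (hC hx)
  constructor
  · rintro ⟨⟨x, hx⟩, hconn, hd⟩ v hv
    rw [Finset.mem_Icc] at hv
    by_contra hvC
    have inv : ∀ y, Relation.ReflTransGen
        (fun a b => a ∈ C ∧ b ∈ C ∧ (adjD (m + 4) a b ∨ adjD (m + 4) b a)) x y →
        (x < v ↔ y < v) := by
      intro y h
      induction h with
      | refl => rfl
      | @tail b c h1 h2 ih =>
        rw [ih]
        obtain ⟨hb, hc, hbc⟩ := h2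
        have hb' : b ≠ v := fun h => hvC (h ▸ hb)
        have hc' : c ≠ v := fun h => hvC (h ▸ hc)
        unfold adjD at hbc
        omega
    have hxv : x ≠ v := fun h => hvC (h ▸ hx)
    have hall : ∀ y ∈ C, y ≠ v ∧ (x < v ↔ y < v) :=
      fun y hy => ⟨fun h => hvC (h ▸ hy), inv y (hconn x hx y hy)⟩
    by_cases hlt : x < v
    · rcases hd (m + 3) (Finset.mem_Icc.2 (by omega)) with h | ⟨a, ha, haa⟩
      · have := hall _ h
        omega
      · have := hall _ ha
        have := hC' _ ha
        unfold adjD at haa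
        omega
    · rcases hd 1 (Finset.mem_Icc.2 (by omega)) with h | ⟨a, ha, haa⟩
      · have := hall _ h
        omega
      · have := hall _ ha
        have := hC' _ ha
        unfold adjD at haa
        omega
  · intro hM
    have hM' : ∀ x, 2 ≤ x → x ≤ m + 2 → x ∈ C := fun x h1 h2 => hM (Finset.mem_Icc.2 ⟨h1, h2⟩)
    have h2 : 2 ∈ C := hM' 2 (by omega) (by omega)
    have reach : ∀ k, k ≤ m → Relation.ReflTransGen
        (fun a b => a ∈ C ∧ b ∈ C ∧ (adjD (m + 4) a b ∨ adjD (m + 4) b a)) 2 (k + 2) := by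
      intro k
      induction k with
      | zero => intro _; exact .refl
      | succ k ih =>
        intro hk
        refine .tail (ih (by omega)) ⟨hM' _ (by omega) (by omega), hM' _ (by omega) (by omega), ?_⟩
        unfold adjD
        omega
    have reach' : ∀ y ∈ C, Relation.ReflTransGen
        (fun a b => a ∈ C ∧ b ∈ C ∧ (adjD (m + 4) a b ∨ adjD (m + 4) b a)) 2 y := by
      intro y hy
      have hy' := hC' y hy
      rcases (by omega : y = 1 ∨ (2 ≤ y ∧ y ≤ m + 2) ∨ m + 3 ≤ y) with h | h | h
      · refine .single ⟨h2, hy, ?_⟩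
        unfold adjD
        omega
      · have := reach (y - 2) (by omega)
        rwa [Nat.sub_add_cancel h.1] at this
      · refine .tail (reach m le_rfl) ⟨hM' _ (by omega) le_rfl, hy, ?_⟩
        unfold adjD
        omega
    refine ⟨⟨2, h2⟩, fun x hx y hy => (rtg_symm _ _ (reach' x hx)).trans (reach' y hy), ?_⟩
    intro v hv
    rw [Finset.mem_Icc] at hv
    rcases (by omega : v = 1 ∨ (2 ≤ v ∧ v ≤ m + 2) ∨ m + 3 ≤ v) with h | h | h
    · refine Or.inr ⟨2, h2, ?_⟩
      unfold adjD
      omega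
    · exact Or.inl (hM' v h.1 h.2)
    · refine Or.inr ⟨m + 2, hM' _ (by omega) le_rfl, ?_⟩
      unfold adjD
      omega

lemma choose_two_int (n : ℕ) : 2 * (((n + 1).choose 2 : ℕ) : ℤ) = (n + 1) * n := by
  have h3 : 2 * (n + 1).choose 2 = (n + 1) * n := by
    rw [Nat.choose_two_right, Nat.add_sub_cancel]
    refine Nat.mul_div_cancel' ?_
    rw [mul_comm]
    exact (Nat.even_mul_succ_self n).two_dvd
  exact_mod_cast h3

lemma deriv_value (m : ℕ) :
    ∑ J ∈ (Finset.Icc 1 (m + 4)).powerset, (-1 : ℤ) ^ J.card * (degD (m + 4) J : ℤ)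
      = (-1) ^ m * ((m : ℤ) + 2) := by
  unfold degD
  simp only [Nat.cast_sum]
  rw [main_sum]
  have himg : (Finset.Icc 1 (m + 4)).powerset.filter
      (Good (adjD (m + 4)) (Finset.Icc 1 (m + 4))) =
      ({1, m + 3, m + 4} : Finset ℕ).powerset.image (fun S => S ∪ Finset.Icc 2 (m + 2)) := by
    ext C
    rw [Finset.mem_filter, Finset.mem_image, Finset.mem_powerset]
    constructor
    · rintro ⟨h1, h2⟩
      rw [good_iff m C h1] at h2
      refine ⟨C \ Finset.Icc 2 (m + 2), ?_, Finset.sdiff_union_of_subset h2⟩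
      rw [Finset.mem_powerset]
      intro x hx
      rw [Finset.mem_sdiff] at hx
      have := h1 hx.1
      simp only [Finset.mem_Icc, Finset.mem_insert, Finset.mem_singleton] at *
      omega
    · rintro ⟨S, hS, rfl⟩
      rw [Finset.mem_powerset] at hS
      have h1 : S ∪ Finset.Icc 2 (m + 2) ⊆ Finset.Icc 1 (m + 4) := by
        intro x hx
        rcases Finset.mem_union.1 hx with h | h
        · have := hS h
          simp only [Finset.mem_Icc, Finset.mem_insert, Finset.mem_singleton] at *
          omega
        · simp only [Finset.mem_Icc] at *
          omega
      exact ⟨h1, (good_iff m _ h1).2 Finset.subset_union_right⟩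
  have hinj : Set.InjOn (fun S : Finset ℕ => S ∪ Finset.Icc 2 (m + 2))
      (({1, m + 3, m + 4} : Finset ℕ).powerset : Set (Finset ℕ)) := by
    have aux : ∀ S ∈ ({1, m + 3, m + 4} : Finset ℕ).powerset,
        (S ∪ Finset.Icc 2 (m + 2)) \ Finset.Icc 2 (m + 2) = S := by
      intro S hS
      rw [Finset.mem_powerset] at hS
      apply Finset.union_sdiff_cancel_right
      rw [Finset.disjoint_left]
      intro x hx
      have := hS hx
      simp only [Finset.mem_Icc, Finset.mem_insert, Finset.mem_singleton] at *
      omega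
    intro S hS T hT h
    rw [← aux S hS, ← aux T hT]
    exact congrArg (· \ Finset.Icc 2 (m + 2)) h
  rw [himg, Finset.sum_image hinj]
  have n1 : 1 ∉ ({m + 3, m + 4} : Finset ℕ) := by simp
  have n2 : m + 3 ∉ ({m + 4} : Finset ℕ) := by simp
  rw [Finset.sum_powerset_insert n1, Finset.sum_powerset_insert n2,
    Finset.sum_powerset_insert n2]
  have e : ({m + 4} : Finset ℕ) = insert (m + 4) ∅ := rfl
  rw [e]
  simp only [Finset.sum_powerset_insert (Finset.notMem_empty (m + 4)), Finset.powerset_empty,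
    Finset.sum_singleton]
  simp [Finset.insert_union, Finset.card_insert_of_notMem]
  have c1 := choose_two_int (m + 1)
  have c2 := choose_two_int (m + 1 + 1)
  have c3 := choose_two_int (m + 1 + 1 + 1)
  push_cast at c1 c2 c3
  apply mul_left_cancel₀ (two_ne_zero : (2 : ℤ) ≠ 0)
  generalize (((m + 1 + 1).choose 2 : ℕ) : ℤ) = A at *
  generalize (((m + 1 + 1 + 1).choose 2 : ℕ) : ℤ) = B at *
  generalize (((m + 1 + 1 + 1 + 1).choose 2 : ℕ) : ℤ) = D at *
  linear_combination (-1 : ℤ) ^ m * (-c1 + 3 * c2 - 2 * c3)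

/-- For every integer `l ≥ 5`, `N'_{D_l}(1) − N'_{D_{l-1}}(1) = (-1)^l · (2l - 5)`. -/
theorem deriv_one_typeD_difference (l : ℕ) (hl : 5 ≤ l) :
    (∑ J ∈ (Finset.Icc 1 l).powerset, (-1 : ℤ) ^ J.card * (degD l J : ℤ)) -
      (∑ J ∈ (Finset.Icc 1 (l - 1)).powerset, (-1 : ℤ) ^ J.card * (degD (l - 1) J : ℤ))
      = (-1) ^ l * (2 * (l : ℤ) - 5) := by
  obtain ⟨m, rfl⟩ : ∃ m, l = m + 1 + 4 := ⟨l - 5, by omega⟩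
  have h := deriv_value (m + 1)
  have h' := deriv_value m
  rw [show m + 1 + 4 - 1 = m + 4 by omega, h, h']
  push_cast
  ring
end
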